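/- arXiv:2304.14611 — 9 statements merged into one kernel-verified Lean document; each statement's English description precedes it below -/
import Mathlib

section
/- (Theorem 1, equality of values.) The infimum of the objective f(w, r) over the RDP feasible set A equals the infimum of f(w, r) over the WBM feasible set B: sInf { f(w, r) | (w, r) ∈ A } = sInf { f(w, r) | (w, Π, r) ∈ B }. -/
open Finset

/-- A conditional distribution (channel) from `Fin M` to `Fin N`. -/
def CondDist {M N : ℕ} (w : Fin M → Fin N → ℝ) : Prop :=
  (∀ i j, w i j ≥ 0) ∧ (∀ i, ∑ j, w i j = 1)

/-- A coupling of `(r, p)`. -/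
def Coupling {M N : ℕ} (r : Fin N → ℝ) (p : Fin M → ℝ)
    (Pi : Fin M → Fin N → ℝ) : Prop :=
  (∀ i j, Pi i j ≥ 0) ∧ (∀ j, ∑ i, Pi i j = r j) ∧ (∀ i, ∑ j, Pi i j = p i)

/-- The objective of the RDP problem (with the convention `Real.log 0 = 0`). -/
noncomputable def fObj {M N : ℕ} (p : Fin M → ℝ)
    (w : Fin M → Fin N → ℝ) (r : Fin N → ℝ) : ℝ :=
  ∑ i, ∑ j, w i j * p i * (Real.log (w i j) - Real.log (r j))

/-- The Wasserstein perception between `p` and `r` with cost `c`. -/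
noncomputable def Wass {M N : ℕ} (p : Fin M → ℝ) (r : Fin N → ℝ)
    (c : Fin M → Fin N → ℝ) : ℝ :=
  sInf {v : ℝ | ∃ Pi : Fin M → Fin N → ℝ,
    Coupling r p Pi ∧ v = ∑ i, ∑ j, Pi i j * c i j}

/-- The RDP feasible set `A`. -/
noncomputable def memA {M N : ℕ} (p : Fin M → ℝ) (d c : Fin M → Fin N → ℝ) (D P : ℝ)
    (w : Fin M → Fin N → ℝ) (r : Fin N → ℝ) : Prop :=
  CondDist w ∧ (∀ j, r j = ∑ i, w i j * p i) ∧
    (∑ i, ∑ j, w i j * p i * d i j ≤ D) ∧ Wass p r c ≤ P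

/-- The WBM feasible set `B`. -/
def memB {M N : ℕ} (p : Fin M → ℝ) (d c : Fin M → Fin N → ℝ) (D P : ℝ)
    (w Pi : Fin M → Fin N → ℝ) (r : Fin N → ℝ) : Prop :=
  CondDist w ∧ (∀ j, r j = ∑ i, w i j * p i) ∧ Coupling r p Pi ∧
    (∑ i, ∑ j, w i j * p i * d i j ≤ D) ∧ (∑ i, ∑ j, Pi i j * c i j ≤ P)

/-- The set of couplings is compact. -/
theorem coupling_isCompact {M N : ℕ} (r : Fin N → ℝ) (p : Fin M → ℝ) :
    IsCompact {Q : Fin M → Fin N → ℝ | Coupling r p Q} := by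
  refine IsCompact.of_isClosed_subset
    (isCompact_Icc (a := (0 : Fin M → Fin N → ℝ)) (b := fun i _ => p i)) ?_ ?_
  · simp only [Coupling, Set.setOf_and, Set.setOf_forall]
    refine IsClosed.inter ?_ (IsClosed.inter ?_ ?_)
    · exact isClosed_iInter fun i => isClosed_iInter fun j =>
        isClosed_le (by fun_prop) (by fun_prop)
    · exact isClosed_iInter fun j => isClosed_eq (by fun_prop) (by fun_prop)
    · exact isClosed_iInter fun i => isClosed_eq (by fun_prop) (by fun_prop)
  · intro Q hQ
    refine ⟨fun i j => hQ.1 i j, fun i j => ?_⟩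
    show Q i j ≤ p i
    rw [← hQ.2.2 i]
    exact Finset.single_le_sum (f := fun j => Q i j) (fun k _ => hQ.1 i k) (Finset.mem_univ j)

/-- Theorem 1, equality of values: the infimum of the objective `f` over the RDP feasible
set `A` equals the infimum of `f` over the WBM feasible set `B`. -/
theorem rdp_eq_wbm_value
    (M N : ℕ) (hM : 0 < M) (hN : 0 < N)
    (p : Fin M → ℝ) (hp : ∀ i, p i ≥ 0) (hps : ∑ i, p i = 1)
    (d : Fin M → Fin N → ℝ) (hd : ∀ i j, d i j ≥ 0)
    (c : Fin M → Fin N → ℝ) (hc : ∀ i j, c i j ≥ 0)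
    (D : ℝ) (hD : D ≥ 0) (P : ℝ) (hP : P ≥ 0) :
    sInf {v : ℝ | ∃ w : Fin M → Fin N → ℝ, ∃ r : Fin N → ℝ,
        memA p d c D P w r ∧ v = fObj p w r} =
    sInf {v : ℝ | ∃ w Pi : Fin M → Fin N → ℝ, ∃ r : Fin N → ℝ,
        memB p d c D P w Pi r ∧ v = fObj p w r} := by
  congr 1
  ext v
  constructor
  · rintro ⟨w, r, ⟨hw, hr, hdist, hW⟩, rfl⟩
    have hne : Coupling r p (fun i j => w i j * p i) := by
      refine ⟨fun i j => mul_nonneg (hw.1 i j) (hp i), fun j => (hr j).symm, fun i => ?_⟩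
      rw [← Finset.sum_mul, hw.2 i, one_mul]
    obtain ⟨Q, hQ, hQm⟩ := (coupling_isCompact r p).exists_isMinOn ⟨_, hne⟩
      (f := fun Q : Fin M → Fin N → ℝ => ∑ i, ∑ j, Q i j * c i j)
      (Continuous.continuousOn (by fun_prop))
    refine ⟨w, Q, r, ⟨hw, hr, hQ, hdist, le_trans ?_ hW⟩, rfl⟩
    refine le_csInf ⟨_, Q, hQ, rfl⟩ ?_
    rintro v ⟨R, hR, rfl⟩
    exact hQm hR
  · rintro ⟨w, Q, r, ⟨hw, hr, hQ, hdist, hW⟩, rfl⟩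
    refine ⟨w, r, ⟨hw, hr, hdist, le_trans (csInf_le ⟨0, ?_⟩ ⟨Q, hQ, rfl⟩) hW⟩, rfl⟩
    rintro v ⟨R, hR, rfl⟩
    exact Finset.sum_nonneg fun i _ => Finset.sum_nonneg fun j _ =>
      mul_nonneg (hR.1 i j) (hc i j)
end

section
/- (Theorem 1, transfer of optimal solutions.) If the triple (w, Π, r) minimizes f over the WBM feasible set B, then the pair (w, r) lies in the RDP feasible set A and minimizes f over A. Conversely, if (w, r) minimizes f over A, then there exists a coupling Π of (r, p) such that (w, Π, r) lies in B and minimizes f over B. -/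
open Finset

theorem exists_opt_coupling {M N : ℕ} (p : Fin M → ℝ) (r : Fin N → ℝ)
    (c : Fin M → Fin N → ℝ) (hne : ∃ Q, Coupling r p Q) :
    ∃ Q, Coupling r p Q ∧ ∑ i, ∑ j, Q i j * c i j = Wass p r c := by
  have hclosed : IsClosed {Q : Fin M → Fin N → ℝ | Coupling r p Q} := by
    have h1 : IsClosed {Q : Fin M → Fin N → ℝ | ∀ i j, Q i j ≥ 0} := by
      simp only [Set.setOf_forall]
      exact isClosed_iInter fun i => isClosed_iInter fun j =>
        isClosed_le continuous_const (by fun_prop)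
    have h2 : IsClosed {Q : Fin M → Fin N → ℝ | ∀ j, ∑ i, Q i j = r j} := by
      simp only [Set.setOf_forall]
      exact isClosed_iInter fun j => isClosed_eq (by fun_prop) continuous_const
    have h3 : IsClosed {Q : Fin M → Fin N → ℝ | ∀ i, ∑ j, Q i j = p i} := by
      simp only [Set.setOf_forall]
      exact isClosed_iInter fun j => isClosed_eq (by fun_prop) continuous_const
    exact h1.inter (h2.inter h3)
  have hcomp : IsCompact {Q : Fin M → Fin N → ℝ | Coupling r p Q} := by
    refine IsCompact.of_isClosed_subset
      (isCompact_univ_pi fun i => isCompact_univ_pi fun _ : Fin N =>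
        (isCompact_Icc : IsCompact (Set.Icc 0 (p i)))) hclosed ?_
    rintro Q ⟨h0, -, h2⟩ i - j -
    refine ⟨h0 i j, ?_⟩
    rw [← h2 i]
    exact Finset.single_le_sum (f := fun j => Q i j) (fun j _ => h0 i j) (Finset.mem_univ j)
  have himg : IsCompact {v : ℝ | ∃ Q : Fin M → Fin N → ℝ,
      Coupling r p Q ∧ v = ∑ i, ∑ j, Q i j * c i j} := by
    have := hcomp.image (f := fun Q : Fin M → Fin N → ℝ => ∑ i, ∑ j, Q i j * c i j)
      (by fun_prop)
    convert this using 1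
    ext v
    simp [eq_comm]
  obtain ⟨Q, hQ⟩ := hne
  obtain ⟨Q', hQ', h⟩ := himg.sInf_mem ⟨_, Q, hQ, rfl⟩
  exact ⟨Q', hQ', h.symm⟩

theorem memA_of_memB {M N : ℕ} {p : Fin M → ℝ} {d c : Fin M → Fin N → ℝ} {D P : ℝ}
    (hc : ∀ i j, c i j ≥ 0) {w Q : Fin M → Fin N → ℝ} {r : Fin N → ℝ}
    (h : memB p d c D P w Q r) : memA p d c D P w r := by
  obtain ⟨h1, h2, h3, h4, h5⟩ := h
  refine ⟨h1, h2, h4, le_trans (csInf_le ⟨0, ?_⟩ ⟨Q, h3, rfl⟩) h5⟩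
  rintro v ⟨Q', hQ', rfl⟩
  exact Finset.sum_nonneg fun i _ => Finset.sum_nonneg fun j _ =>
    mul_nonneg (hQ'.1 i j) (hc i j)

theorem exists_memB_of_memA {M N : ℕ} {p : Fin M → ℝ} {d c : Fin M → Fin N → ℝ} {D P : ℝ}
    (hp : ∀ i, p i ≥ 0) {w : Fin M → Fin N → ℝ} {r : Fin N → ℝ}
    (h : memA p d c D P w r) : ∃ Q, memB p d c D P w Q r := by
  obtain ⟨h1, h2, h3, h4⟩ := h
  obtain ⟨Q, hQ, hv⟩ := exists_opt_coupling p r c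
    ⟨fun i j => w i j * p i, fun i j => mul_nonneg (h1.1 i j) (hp i), fun j => (h2 j).symm,
      fun i => by rw [← Finset.sum_mul, h1.2 i, one_mul]⟩
  exact ⟨Q, h1, h2, hQ, h3, hv.trans_le h4⟩

/-- Theorem 1, transfer of optimal solutions.  If `(w, Π, r)` minimizes `f` over the WBM
feasible set `B`, then `(w, r)` lies in the RDP feasible set `A` and minimizes `f` over `A`.
Conversely, if `(w, r)` minimizes `f` over `A`, then there is a coupling `Π` of `(r, p)` such
that `(w, Π, r)` lies in `B` and minimizes `f` over `B`. -/
theorem rdp_wbm_minimizer_transfer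
    (M N : ℕ) (hM : 0 < M) (hN : 0 < N)
    (p : Fin M → ℝ) (hp : ∀ i, p i ≥ 0) (hps : ∑ i, p i = 1)
    (d : Fin M → Fin N → ℝ) (hd : ∀ i j, d i j ≥ 0)
    (c : Fin M → Fin N → ℝ) (hc : ∀ i j, c i j ≥ 0)
    (D : ℝ) (hD : D ≥ 0) (P : ℝ) (hP : P ≥ 0) :
    (∀ (w Pi : Fin M → Fin N → ℝ) (r : Fin N → ℝ),
      memB p d c D P w Pi r →
      (∀ (w' Pi' : Fin M → Fin N → ℝ) (r' : Fin N → ℝ),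
        memB p d c D P w' Pi' r' → fObj p w r ≤ fObj p w' r') →
      memA p d c D P w r ∧
        ∀ (w' : Fin M → Fin N → ℝ) (r' : Fin N → ℝ),
          memA p d c D P w' r' → fObj p w r ≤ fObj p w' r') ∧
    (∀ (w : Fin M → Fin N → ℝ) (r : Fin N → ℝ),
      memA p d c D P w r →
      (∀ (w' : Fin M → Fin N → ℝ) (r' : Fin N → ℝ),
        memA p d c D P w' r' → fObj p w r ≤ fObj p w' r') →
      ∃ Pi : Fin M → Fin N → ℝ, Coupling r p Pi ∧
        memB p d c D P w Pi r ∧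
        ∀ (w' Pi' : Fin M → Fin N → ℝ) (r' : Fin N → ℝ),
          memB p d c D P w' Pi' r' → fObj p w r ≤ fObj p w' r') := by
  refine ⟨fun w Q r hB hmin => ⟨memA_of_memB hc hB, fun w' r' hA => ?_⟩,
    fun w r hA hmin => ?_⟩
  · obtain ⟨Q', hQ'⟩ := exists_memB_of_memA hp hA
    exact hmin _ _ _ hQ'
  · obtain ⟨Q, hQ⟩ := exists_memB_of_memA hp hA
    exact ⟨Q, hQ.2.2.1, hQ, fun w' Q' r' hB => hmin _ _ (memA_of_memB hc hB)⟩
end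

section
/- (Attainment for the WBM-RDP.) If the WBM feasible set B is nonempty, then the infimum of f(w, r) over B is attained: there exists (w*, Π*, r*) ∈ B with f(w*, r*) ≤ f(w, r) for all (w, Π, r) ∈ B. -/
open Finset

/-- Attainment for the WBM-RDP: if the WBM feasible set `B` is nonempty, the infimum of
`f(w, r)` over `B` is attained. -/
theorem wbm_infimum_attained
    (M N : ℕ) (hM : 0 < M) (hN : 0 < N)
    (p : Fin M → ℝ) (hp : ∀ i, p i ≥ 0) (hps : ∑ i, p i = 1)
    (d : Fin M → Fin N → ℝ) (hd : ∀ i j, d i j ≥ 0)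
    (c : Fin M → Fin N → ℝ) (hc : ∀ i j, c i j ≥ 0)
    (D : ℝ) (hD : D ≥ 0) (P : ℝ) (hP : P ≥ 0)
    (hB : ∃ w Pi : Fin M → Fin N → ℝ, ∃ r : Fin N → ℝ, memB p d c D P w Pi r) :
    ∃ wstar Pistar : Fin M → Fin N → ℝ, ∃ rstar : Fin N → ℝ,
      memB p d c D P wstar Pistar rstar ∧
      ∀ (w Pi : Fin M → Fin N → ℝ) (r : Fin N → ℝ),
        memB p d c D P w Pi r → fObj p wstar rstar ≤ fObj p w r := by
  have key : ∀ (w : Fin M → Fin N → ℝ) (r : Fin N → ℝ), (∀ j, r j = ∑ i, w i j * p i) →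
      fObj p w r = (∑ i, ∑ j, p i * (w i j * Real.log (w i j)))
        - ∑ j, (∑ i, w i j * p i) * Real.log (∑ i, w i j * p i) := by
    intro w r hr
    have h1 : ∑ j, (∑ i, w i j * p i) * Real.log (∑ i, w i j * p i)
        = ∑ i, ∑ j, w i j * p i * Real.log (r j) := by
      rw [Finset.sum_comm]
      refine Finset.sum_congr rfl fun j _ => ?_
      rw [← hr j, hr j, Finset.sum_mul]
    rw [h1, fObj, ← Finset.sum_sub_distrib]
    refine Finset.sum_congr rfl fun i _ => ?_
    rw [← Finset.sum_sub_distrib]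
    refine Finset.sum_congr rfl fun j _ => ?_
    ring
  let S : Set ((Fin M → Fin N → ℝ) × (Fin M → Fin N → ℝ)) :=
    {x | memB p d c D P x.1 x.2 (fun j => ∑ i, x.1 i j * p i)}
  have hsub : S ⊆ Set.Icc 0 1 := by
    rintro ⟨w, Q⟩ ⟨⟨hw0, hw1⟩, -, ⟨hQ0, -, hQ1⟩, -, -⟩
    refine ⟨⟨fun i j => hw0 i j, fun i j => hQ0 i j⟩, ⟨fun i j => ?_, fun i j => ?_⟩⟩
    · have := Finset.single_le_sum (f := fun j => w i j) (fun j _ => hw0 i j) (Finset.mem_univ j)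
      have h2 := hw1 i
      simp only [Prod.fst_one, Pi.one_apply] at *
      linarith
    · have := Finset.single_le_sum (f := fun j => Q i j) (fun j _ => hQ0 i j) (Finset.mem_univ j)
      have h2 := hQ1 i
      have h3 := Finset.single_le_sum (f := p) (fun j _ => hp j) (Finset.mem_univ i)
      simp only [Prod.snd_one, Pi.one_apply] at *
      linarith
  have hclosed : IsClosed S := by
    simp only [S, memB, CondDist, Coupling, Set.ofPred_and, Set.ofPred_forall, ge_iff_le]
    refine IsClosed.inter (IsClosed.inter ?_ ?_) (IsClosed.inter ?_ (IsClosed.inter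
      (IsClosed.inter ?_ (IsClosed.inter ?_ ?_)) (IsClosed.inter ?_ ?_)))
    · exact isClosed_iInter fun i => isClosed_iInter fun j =>
        isClosed_le (by fun_prop) (by fun_prop)
    · exact isClosed_iInter fun i => isClosed_eq (by fun_prop) (by fun_prop)
    · simp
    · exact isClosed_iInter fun i => isClosed_iInter fun j =>
        isClosed_le (by fun_prop) (by fun_prop)
    · exact isClosed_iInter fun i => isClosed_eq (by fun_prop) (by fun_prop)
    · exact isClosed_iInter fun i => isClosed_eq (by fun_prop) (by fun_prop)
    · exact isClosed_le (by fun_prop) (by fun_prop)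
    · exact isClosed_le (by fun_prop) (by fun_prop)
  have hcomp : IsCompact S := isCompact_Icc.of_isClosed_subset hclosed hsub
  have hmem : ∀ w Q r, memB p d c D P w Q r → (w, Q) ∈ S := by
    intro w Q r h
    have hr : r = fun j => ∑ i, w i j * p i := funext h.2.1
    rw [hr] at h
    exact h
  have hne : S.Nonempty := by
    obtain ⟨w, Q, r, h⟩ := hB
    exact ⟨(w, Q), hmem w Q r h⟩
  let g : ((Fin M → Fin N → ℝ) × (Fin M → Fin N → ℝ)) → ℝ := fun x =>
    (∑ i, ∑ j, p i * (x.1 i j * Real.log (x.1 i j)))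
        - ∑ j, (∑ i, x.1 i j * p i) * Real.log (∑ i, x.1 i j * p i)
  have hg : Continuous g := by
    refine Continuous.sub ?_ ?_
    · refine continuous_finsetSum _ fun i _ => continuous_finsetSum _ fun j _ => ?_
      refine continuous_const.mul (Real.continuous_mul_log.comp
        (g := fun x : ℝ => x * Real.log x) (f := fun x : (Fin M → Fin N → ℝ) × (Fin M → Fin N → ℝ) => x.1 i j) (by fun_prop))
    · refine continuous_finsetSum _ fun j _ => ?_
      exact Real.continuous_mul_log.comp (g := fun x : ℝ => x * Real.log x)
        (f := fun x : (Fin M → Fin N → ℝ) × (Fin M → Fin N → ℝ) => ∑ i, x.1 i j * p i) (by fun_prop)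
  obtain ⟨⟨w0, Q0⟩, h0, hmin⟩ := hcomp.exists_isMinOn hne hg.continuousOn
  refine ⟨w0, Q0, _, h0, fun w Q r h => ?_⟩
  rw [key w r h.2.1, key w0 _ (fun j => rfl)]
  exact hmin (hmem w Q r h)
end

section
/- (Uniqueness of the Π-component for the entropy-regularized WBM-RDP.) Let ε > 0 and define the regularized objective f_ε(w, Π, r) = f(w, r) + ε * ∑ i, ∑ j, Π i j * Real.log (Π i j). If (w₁, Π₁, r₁) and (w₂, Π₂, r₂) both minimize f_ε over the WBM feasible set B, then Π₁ = Π₂. -/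
open Finset

theorem aux_tangent (a x s t : ℝ) (ha : 0 ≤ a) (hx : 0 ≤ x) (h : x = 0 → a = 0)
    (hs : 0 < s) (ht : 0 < t) :
    a * (Real.log s - Real.log t) + a - x * s / t ≤ a * (Real.log a - Real.log x) := by
  rcases ha.eq_or_lt with h0 | h0
  · subst h0
    have : 0 ≤ x * s / t := by positivity
    simpa using this
  · have hx' : 0 < x := lt_of_le_of_ne hx (fun e => by have := h e.symm; linarith)
    have h1 := Real.log_le_sub_one_of_pos (show 0 < x * s / (t * a) by positivity)
    rw [Real.log_div (by positivity) (by positivity), Real.log_mul (by positivity) (by positivity),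
      Real.log_mul (by positivity) (by positivity)] at h1
    have h2 := mul_le_mul_of_nonneg_left h1 ha
    have h3 : a * (x * s / (t * a) - 1) = x * s / t - a := by field_simp
    rw [h3] at h2
    nlinarith

theorem aux_logsum (a b x y : ℝ) (ha : 0 ≤ a) (hb : 0 ≤ b) (hx : 0 ≤ x) (hy : 0 ≤ y)
    (hxa : x = 0 → a = 0) (hyb : y = 0 → b = 0) :
    (a + b) / 2 * (Real.log ((a + b) / 2) - Real.log ((x + y) / 2)) ≤
      (a * (Real.log a - Real.log x) + b * (Real.log b - Real.log y)) / 2 := by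
  by_cases hs : a + b = 0
  · have h1 : a = 0 := by linarith
    have h2 : b = 0 := by linarith
    subst h1 h2
    simp
  · have hs' : 0 < (a + b) / 2 := by
      have : 0 < a + b := lt_of_le_of_ne (by linarith) (Ne.symm hs)
      linarith
    have ht' : 0 < (x + y) / 2 := by
      by_contra hcon
      have h1 : x = 0 := by linarith
      have h2 : y = 0 := by linarith
      have := hxa h1
      have := hyb h2
      exact hs (by linarith)
    have e1 := aux_tangent a x _ _ ha hx hxa hs' ht'
    have e2 := aux_tangent b y _ _ hb hy hyb hs' ht'
    have e3 : x * ((a + b) / 2) / ((x + y) / 2) + y * ((a + b) / 2) / ((x + y) / 2) = a + b := by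
      rw [← add_div, ← add_mul, div_eq_iff ht'.ne']
      ring
    nlinarith

theorem aux_ent (a b : ℝ) (ha : 0 ≤ a) (hb : 0 ≤ b) :
    (a + b) / 2 * Real.log ((a + b) / 2) ≤ (a * Real.log a + b * Real.log b) / 2 := by
  have := Real.convexOn_mul_log.2 (Set.mem_Ici.2 ha) (Set.mem_Ici.2 hb)
    (show (0 : ℝ) < 1 / 2 by norm_num).le (show (0 : ℝ) < 1 / 2 by norm_num).le (by norm_num)
  simp only [smul_eq_mul] at this
  rw [show 1 / 2 * a + 1 / 2 * b = (a + b) / 2 by ring] at this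
  linarith

theorem aux_ent_strict (a b : ℝ) (ha : 0 ≤ a) (hb : 0 ≤ b) (hab : a ≠ b) :
    (a + b) / 2 * Real.log ((a + b) / 2) < (a * Real.log a + b * Real.log b) / 2 := by
  have := Real.strictConvexOn_mul_log.2 (Set.mem_Ici.2 ha) (Set.mem_Ici.2 hb) hab
    (show (0 : ℝ) < 1 / 2 by norm_num) (show (0 : ℝ) < 1 / 2 by norm_num) (by norm_num)
  simp only [smul_eq_mul] at this
  rw [show 1 / 2 * a + 1 / 2 * b = (a + b) / 2 by ring] at this
  linarith

theorem aux_sum {M N : ℕ} (f g : Fin M → Fin N → ℝ) :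
    ∑ i, ∑ j, (f i j + g i j) / 2 = (∑ i, ∑ j, f i j + ∑ i, ∑ j, g i j) / 2 := by
  simp only [← Finset.sum_div, Finset.sum_add_distrib]

theorem aux_sum1 {N : ℕ} (f g : Fin N → ℝ) :
    ∑ j, (f j + g j) / 2 = (∑ j, f j + ∑ j, g j) / 2 := by
  simp only [← Finset.sum_div, Finset.sum_add_distrib]

theorem aux_mid {M N : ℕ} (p : Fin M → ℝ) (d c : Fin M → Fin N → ℝ) (D P : ℝ)
    (w₁ Pi₁ : Fin M → Fin N → ℝ) (r₁ : Fin N → ℝ)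
    (w₂ Pi₂ : Fin M → Fin N → ℝ) (r₂ : Fin N → ℝ)
    (h₁ : memB p d c D P w₁ Pi₁ r₁) (h₂ : memB p d c D P w₂ Pi₂ r₂) :
    memB p d c D P (fun i j => (w₁ i j + w₂ i j) / 2) (fun i j => (Pi₁ i j + Pi₂ i j) / 2)
      (fun j => (r₁ j + r₂ j) / 2) := by
  obtain ⟨⟨a1, a2⟩, a3, ⟨a4, a5, a6⟩, a7, a8⟩ := h₁
  obtain ⟨⟨b1, b2⟩, b3, ⟨b4, b5, b6⟩, b7, b8⟩ := h₂
  refine ⟨⟨fun i j => ?_, fun i => ?_⟩, fun j => ?_, ⟨fun i j => ?_, fun j => ?_, fun i => ?_⟩,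
    ?_, ?_⟩
  · have := a1 i j
    have := b1 i j
    dsimp only
    linarith
  · rw [aux_sum1, a2, b2]; norm_num
  · dsimp only
    rw [a3, b3, ← aux_sum1]
    exact Finset.sum_congr rfl fun i _ => by ring
  · have := a4 i j
    have := b4 i j
    dsimp only
    linarith
  · rw [aux_sum1, a5, b5]
  · rw [aux_sum1, a6, b6]; ring
  · have : ∑ i, ∑ j, (w₁ i j + w₂ i j) / 2 * p i * d i j
        = ∑ i, ∑ j, (w₁ i j * p i * d i j + w₂ i j * p i * d i j) / 2 :=
      Finset.sum_congr rfl fun i _ => Finset.sum_congr rfl fun j _ => by ring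
    rw [this, aux_sum]
    linarith
  · have : ∑ i, ∑ j, (Pi₁ i j + Pi₂ i j) / 2 * c i j
        = ∑ i, ∑ j, (Pi₁ i j * c i j + Pi₂ i j * c i j) / 2 :=
      Finset.sum_congr rfl fun i _ => Finset.sum_congr rfl fun j _ => by ring
    rw [this, aux_sum]
    linarith

theorem aux_supp {M N : ℕ} (p : Fin M → ℝ) (hp : ∀ i, p i ≥ 0) (w : Fin M → Fin N → ℝ)
    (hw : ∀ i j, w i j ≥ 0) (r : Fin N → ℝ) (hr : ∀ j, r j = ∑ i, w i j * p i)
    (i : Fin M) (j : Fin N) (hi : p i ≠ 0) (h : r j = 0) : w i j = 0 := by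
  rw [hr, Finset.sum_eq_zero_iff_of_nonneg (fun k _ => mul_nonneg (hw k j) (hp k))] at h
  exact (mul_eq_zero.1 (h i (Finset.mem_univ i))).resolve_right hi

theorem aux_f {M N : ℕ} (p : Fin M → ℝ) (hp : ∀ i, p i ≥ 0)
    (w₁ w₂ : Fin M → Fin N → ℝ) (r₁ r₂ : Fin N → ℝ)
    (hw₁ : ∀ i j, w₁ i j ≥ 0) (hw₂ : ∀ i j, w₂ i j ≥ 0)
    (hr₁ : ∀ j, r₁ j = ∑ i, w₁ i j * p i) (hr₂ : ∀ j, r₂ j = ∑ i, w₂ i j * p i) :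
    fObj p (fun i j => (w₁ i j + w₂ i j) / 2) (fun j => (r₁ j + r₂ j) / 2) ≤
      (fObj p w₁ r₁ + fObj p w₂ r₂) / 2 := by
  unfold fObj
  rw [← aux_sum]
  refine Finset.sum_le_sum fun i _ => Finset.sum_le_sum fun j _ => ?_
  by_cases hi : p i = 0
  · simp [hi]
  have n1 : 0 ≤ r₁ j := by
    rw [hr₁]; exact Finset.sum_nonneg fun k _ => mul_nonneg (hw₁ k j) (hp k)
  have n2 : 0 ≤ r₂ j := by
    rw [hr₂]; exact Finset.sum_nonneg fun k _ => mul_nonneg (hw₂ k j) (hp k)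
  have h := mul_le_mul_of_nonneg_left
    (aux_logsum (w₁ i j) (w₂ i j) (r₁ j) (r₂ j) (hw₁ i j) (hw₂ i j) n1 n2
    (aux_supp p hp w₁ hw₁ r₁ hr₁ i j hi) (aux_supp p hp w₂ hw₂ r₂ hr₂ i j hi)) (hp i)
  dsimp only
  linarith

/-- Uniqueness of the `Π`-component for the entropy-regularized WBM-RDP: any two minimizers
of `f_ε(w, Π, r) = f(w, r) + ε * ∑ i j, Π i j * log (Π i j)` over the WBM feasible set `B`
have the same `Π`-component. -/
theorem regularized_wbm_Pi_unique
    (M N : ℕ) (hM : 0 < M) (hN : 0 < N)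
    (p : Fin M → ℝ) (hp : ∀ i, p i ≥ 0) (hps : ∑ i, p i = 1)
    (d : Fin M → Fin N → ℝ) (hd : ∀ i j, d i j ≥ 0)
    (c : Fin M → Fin N → ℝ) (hc : ∀ i j, c i j ≥ 0)
    (D : ℝ) (hD : D ≥ 0) (P : ℝ) (hP : P ≥ 0)
    (ε : ℝ) (hε : ε > 0)
    (w₁ Pi₁ : Fin M → Fin N → ℝ) (r₁ : Fin N → ℝ)
    (w₂ Pi₂ : Fin M → Fin N → ℝ) (r₂ : Fin N → ℝ)
    (h₁ : memB p d c D P w₁ Pi₁ r₁)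
    (h₂ : memB p d c D P w₂ Pi₂ r₂)
    (hmin₁ : ∀ (w Pi : Fin M → Fin N → ℝ) (r : Fin N → ℝ), memB p d c D P w Pi r →
      fObj p w₁ r₁ + ε * ∑ i, ∑ j, Pi₁ i j * Real.log (Pi₁ i j) ≤
        fObj p w r + ε * ∑ i, ∑ j, Pi i j * Real.log (Pi i j))
    (hmin₂ : ∀ (w Pi : Fin M → Fin N → ℝ) (r : Fin N → ℝ), memB p d c D P w Pi r →
      fObj p w₂ r₂ + ε * ∑ i, ∑ j, Pi₂ i j * Real.log (Pi₂ i j) ≤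
        fObj p w r + ε * ∑ i, ∑ j, Pi i j * Real.log (Pi i j)) :
    Pi₁ = Pi₂ := by
  by_contra hne
  obtain ⟨i₀, hi₀⟩ := Function.ne_iff.1 hne
  obtain ⟨j₀, hj₀⟩ := Function.ne_iff.1 hi₀
  have hmid := aux_mid p d c D P w₁ Pi₁ r₁ w₂ Pi₂ r₂ h₁ h₂
  have e1 := hmin₁ _ _ _ hmid
  have e2 := hmin₂ _ _ _ hmid
  have hf := aux_f p hp w₁ w₂ r₁ r₂ h₁.1.1 h₂.1.1 h₁.2.1 h₂.2.1
  have n1 := h₁.2.2.1.1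
  have n2 := h₂.2.2.1.1
  have hlt : ∑ i, ∑ j, (Pi₁ i j + Pi₂ i j) / 2 * Real.log ((Pi₁ i j + Pi₂ i j) / 2) <
      ∑ i, ∑ j, (Pi₁ i j * Real.log (Pi₁ i j) + Pi₂ i j * Real.log (Pi₂ i j)) / 2 := by
    refine Finset.sum_lt_sum (fun i _ => Finset.sum_le_sum fun j _ =>
      aux_ent _ _ (n1 i j) (n2 i j)) ⟨i₀, Finset.mem_univ _, ?_⟩
    exact Finset.sum_lt_sum (fun j _ => aux_ent _ _ (n1 i₀ j) (n2 i₀ j))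
      ⟨j₀, Finset.mem_univ _, aux_ent_strict _ _ (n1 i₀ j₀) (n2 i₀ j₀) hj₀⟩
  rw [aux_sum] at hlt
  have := mul_lt_mul_of_pos_left hlt hε
  linarith
end

section
/- (Theorem 2, convergence in ε — cluster point form.) Suppose the WBM feasible set B is nonempty and let 𝓜 denote the set of minimizers of f over B. Let (ε_n) be a sequence of positive reals with ε_n → 0, and for each n let (w_n, Π_n, r_n) ∈ B minimize the regularized objective f_{ε_n}(w, Π, r) = f(w, r) + ε_n * ∑ i, ∑ j, Π i j * Real.log (Π i j) over B. Then the sequence (w_n, Π_n, r_n) has a convergent subsequence, and every cluster point (w*, Π*, r*) of the sequence lies in 𝓜 and satisfies ∑ i, ∑ j, Π* i j * Real.log (Π* i j) ≤ ∑ i, ∑ j, Π i j * Real.log (Π i j) for every (w, Π, r) ∈ 𝓜. -/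
open Finset

def setB {M N : ℕ} (p : Fin M → ℝ) (d c : Fin M → Fin N → ℝ) (D P : ℝ) :
    Set ((Fin M → Fin N → ℝ) × (Fin M → Fin N → ℝ) × (Fin N → ℝ)) :=
  {t | memB p d c D P t.1 t.2.1 t.2.2}

lemma setB_closed {M N : ℕ} (p : Fin M → ℝ) (d c : Fin M → Fin N → ℝ) (D P : ℝ) :
    IsClosed (setB p d c D P) := by
  unfold setB memB CondDist Coupling
  simp only [Set.setOf_and, Set.setOf_forall]
  refine IsClosed.inter (IsClosed.inter ?_ ?_) (IsClosed.inter ?_ (IsClosed.inter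
    (IsClosed.inter ?_ (IsClosed.inter ?_ ?_)) (IsClosed.inter ?_ ?_)))
  · exact isClosed_iInter fun i => isClosed_iInter fun j =>
      isClosed_le (by fun_prop) (by fun_prop)
  · exact isClosed_iInter fun i => isClosed_eq (by fun_prop) (by fun_prop)
  · exact isClosed_iInter fun i => isClosed_eq (by fun_prop) (by fun_prop)
  · exact isClosed_iInter fun i => isClosed_iInter fun j =>
      isClosed_le (by fun_prop) (by fun_prop)
  · exact isClosed_iInter fun i => isClosed_eq (by fun_prop) (by fun_prop)
  · exact isClosed_iInter fun i => isClosed_eq (by fun_prop) (by fun_prop)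
  · exact isClosed_le (by fun_prop) (by fun_prop)
  · exact isClosed_le (by fun_prop) (by fun_prop)

lemma setB_compact {M N : ℕ} (p : Fin M → ℝ) (hp : ∀ i, p i ≥ 0) (hps : ∑ i, p i = 1)
    (d c : Fin M → Fin N → ℝ) (D P : ℝ) :
    IsCompact (setB p d c D P) := by
  refine (isCompact_Icc (a := (0 : (Fin M → Fin N → ℝ) × (Fin M → Fin N → ℝ) × (Fin N → ℝ)))
    (b := 1)).of_isClosed_subset (setB_closed p d c D P) ?_
  rintro ⟨w, Q, r⟩ ⟨⟨hw0, hw1⟩, hr, ⟨hQ0, hQr, hQp⟩, -, -⟩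
  simp only at hw0 hw1 hr hQ0 hQr hQp
  have hwle : ∀ i j, w i j ≤ 1 := fun i j => by
    rw [← hw1 i]
    exact Finset.single_le_sum (f := fun j => w i j) (fun j _ => hw0 i j) (mem_univ j)
  have hple : ∀ i, p i ≤ 1 := fun i => by
    rw [← hps]
    exact Finset.single_le_sum (f := p) (fun j _ => hp j) (mem_univ i)
  have hQle : ∀ i j, Q i j ≤ 1 := fun i j => by
    refine le_trans ?_ (hple i)
    rw [← hQp i]
    exact Finset.single_le_sum (f := fun j => Q i j) (fun j _ => hQ0 i j) (mem_univ j)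
  refine ⟨⟨fun i j => hw0 i j, fun i j => hQ0 i j, fun j => ?_⟩,
    ⟨fun i j => hwle i j, fun i j => hQle i j, fun j => ?_⟩⟩
  · show 0 ≤ r j
    rw [hr]
    exact Finset.sum_nonneg fun i _ => mul_nonneg (hw0 i j) (hp i)
  · show r j ≤ 1
    rw [hr, ← hps]
    exact Finset.sum_le_sum fun i _ => mul_le_of_le_one_left (hp i) (hwle i j)

/-- Continuous version of the objective. -/
noncomputable def gObj {M N : ℕ} (p : Fin M → ℝ)
    (w : Fin M → Fin N → ℝ) (r : Fin N → ℝ) : ℝ :=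
  ∑ i, ∑ j, p i * (w i j * Real.log (w i j)) - ∑ j, r j * Real.log (r j)

lemma fObj_eq {M N : ℕ} (p : Fin M → ℝ) (w : Fin M → Fin N → ℝ) (r : Fin N → ℝ)
    (hr : ∀ j, r j = ∑ i, w i j * p i) : fObj p w r = gObj p w r := by
  unfold fObj gObj
  have h : ∑ j, r j * Real.log (r j) = ∑ i, ∑ j, w i j * p i * Real.log (r j) := by
    rw [Finset.sum_comm]
    refine Finset.sum_congr rfl fun j _ => ?_
    rw [← Finset.sum_mul, ← hr]
  rw [h, ← Finset.sum_sub_distrib]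
  refine Finset.sum_congr rfl fun i _ => ?_
  rw [← Finset.sum_sub_distrib]
  refine Finset.sum_congr rfl fun j _ => ?_
  ring

lemma continuous_xlogx {X : Type*} [TopologicalSpace X] {f : X → ℝ} (hf : Continuous f) :
    Continuous fun t => f t * Real.log (f t) :=
  Real.continuous_mul_log.comp hf

open Filter Topology in
/-- Theorem 2 (convergence in `ε`, cluster point form).  If `B ≠ ∅`, `ε_n > 0`, `ε_n → 0`,
and each `(w_n, Π_n, r_n) ∈ B` minimizes `f_{ε_n}` over `B`, then the sequence has a
convergent subsequence and every cluster point lies in the set `𝓜` of minimizers of `f`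
over `B` and has minimal entropy `H(Π)` among all elements of `𝓜`. -/
theorem regularized_minimizers_cluster_points
    (M N : ℕ) (hM : 0 < M) (hN : 0 < N)
    (p : Fin M → ℝ) (hp : ∀ i, p i ≥ 0) (hps : ∑ i, p i = 1)
    (d : Fin M → Fin N → ℝ) (hd : ∀ i j, d i j ≥ 0)
    (c : Fin M → Fin N → ℝ) (hc : ∀ i j, c i j ≥ 0)
    (D : ℝ) (hD : D ≥ 0) (P : ℝ) (hP : P ≥ 0)
    (hB : ∃ w Pi : Fin M → Fin N → ℝ, ∃ r : Fin N → ℝ, memB p d c D P w Pi r)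
    (𝓜 : Set ((Fin M → Fin N → ℝ) × (Fin M → Fin N → ℝ) × (Fin N → ℝ)))
    (h𝓜 : 𝓜 = {t | memB p d c D P t.1 t.2.1 t.2.2 ∧
      ∀ (w Pi : Fin M → Fin N → ℝ) (r : Fin N → ℝ),
        memB p d c D P w Pi r → fObj p t.1 t.2.2 ≤ fObj p w r})
    (ε : ℕ → ℝ) (hε : ∀ n, ε n > 0) (hε0 : Tendsto ε atTop (𝓝 0))
    (x : ℕ → (Fin M → Fin N → ℝ) × (Fin M → Fin N → ℝ) × (Fin N → ℝ))
    (hxB : ∀ n, memB p d c D P (x n).1 (x n).2.1 (x n).2.2)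
    (hxmin : ∀ n, ∀ (w Pi : Fin M → Fin N → ℝ) (r : Fin N → ℝ),
      memB p d c D P w Pi r →
      fObj p (x n).1 (x n).2.2
          + ε n * ∑ i, ∑ j, (x n).2.1 i j * Real.log ((x n).2.1 i j) ≤
        fObj p w r + ε n * ∑ i, ∑ j, Pi i j * Real.log (Pi i j)) :
    (∃ φ : ℕ → ℕ, StrictMono φ ∧
      ∃ L : (Fin M → Fin N → ℝ) × (Fin M → Fin N → ℝ) × (Fin N → ℝ),
        Tendsto (x ∘ φ) atTop (𝓝 L)) ∧
    (∀ L : (Fin M → Fin N → ℝ) × (Fin M → Fin N → ℝ) × (Fin N → ℝ),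
      MapClusterPt L atTop x →
      L ∈ 𝓜 ∧ ∀ t ∈ 𝓜,
        (∑ i, ∑ j, L.2.1 i j * Real.log (L.2.1 i j)) ≤
          ∑ i, ∑ j, t.2.1 i j * Real.log (t.2.1 i j)) := by
  have hH : Continuous fun t : (Fin M → Fin N → ℝ) × (Fin M → Fin N → ℝ) × (Fin N → ℝ) =>
      ∑ i, ∑ j, t.2.1 i j * Real.log (t.2.1 i j) :=
    continuous_finsetSum _ fun i _ => continuous_finsetSum _ fun j _ =>
      continuous_xlogx (by fun_prop)
  have hg : Continuous fun t : (Fin M → Fin N → ℝ) × (Fin M → Fin N → ℝ) × (Fin N → ℝ) =>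
      gObj p t.1 t.2.2 :=
    (continuous_finsetSum _ fun i _ => continuous_finsetSum _ fun j _ =>
      continuous_const.mul (continuous_xlogx (by fun_prop))).sub
    (continuous_finsetSum _ fun j _ => continuous_xlogx (by fun_prop))
  refine ⟨?_, ?_⟩
  · obtain ⟨L, -, φ, hφ, hL⟩ := (setB_compact p hp hps d c D P).tendsto_subseq hxB
    exact ⟨φ, hφ, L, hL⟩
  · intro L hL
    obtain ⟨φ, hφ, hT⟩ := TopologicalSpace.FirstCountableTopology.tendsto_subseq hL
    have hLB : memB p d c D P L.1 L.2.1 L.2.2 :=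
      (setB_closed p d c D P).mem_of_tendsto hT (Eventually.of_forall fun n => hxB (φ n))
    have hTH := (hH.tendsto L).comp hT
    have hTg := (hg.tendsto L).comp hT
    have hTε := hε0.comp hφ.tendsto_atTop
    subst h𝓜
    refine ⟨⟨hLB, fun w Q r hwr => ?_⟩, fun t ht => ?_⟩
    · rw [fObj_eq p L.1 L.2.2 hLB.2.1]
      have h1 := hTg.add (hTε.mul hTH)
      have h2 : Tendsto (fun n => fObj p w r + (ε ∘ φ) n * ∑ i, ∑ j, Q i j * Real.log (Q i j))
          atTop (𝓝 (fObj p w r + 0 * ∑ i, ∑ j, Q i j * Real.log (Q i j))) :=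
        tendsto_const_nhds.add (hTε.mul tendsto_const_nhds)
      have h3 := le_of_tendsto_of_tendsto' h1 h2 (fun n => by
        have := hxmin (φ n) w Q r hwr
        rw [fObj_eq p _ _ (hxB (φ n)).2.1] at this
        exact this)
      simpa using h3
    · refine le_of_tendsto' hTH fun n => ?_
      have h1 := hxmin (φ n) _ _ _ ht.1
      have h2 := ht.2 _ _ _ (hxB (φ n))
      have h3 : ε (φ n) * ∑ i, ∑ j, (x (φ n)).2.1 i j * Real.log ((x (φ n)).2.1 i j) ≤
        ε (φ n) * ∑ i, ∑ j, t.2.1 i j * Real.log (t.2.1 i j) := by linarith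
      exact le_of_mul_le_mul_left h3 (hε _)
end

section
/- (Closed form for the w-update.) Fix a probability vector p : Fin M → ℝ with p i > 0 and ∑ i, p i = 1, a vector r : Fin N → ℝ with r j > 0 and ∑ j, r j = 1, a matrix d : Fin M → Fin N → ℝ with d i j ≥ 0, and λ ≥ 0. Define w* i j = r j * Real.exp (-λ * d i j) / (∑ k, r k * Real.exp (-λ * d i k)). Then w* is a conditional distribution, and for every conditional distribution w, ∑ i, ∑ j, w i j * p i * (Real.log (w i j) - Real.log (r j)) + λ * ∑ i, ∑ j, w i j * p i * d i j ≥ ∑ i, ∑ j, w* i j * p i * (Real.log (w* i j) - Real.log (r j)) + λ * ∑ i, ∑ j, w* i j * p i * d i j = -∑ i, p i * Real.log (∑ k, r k * Real.exp (-λ * d i k)), with equality only when w = w*. -/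
open Finset

/-- Closed form for the `w`-update: `w* i j = r j * exp (-λ d i j) / ∑ k, r k * exp (-λ d i k)`
is a conditional distribution minimizing the Lagrangian
`f(w, r) + λ * ∑ i j, w i j * p i * d i j` uniquely among conditional distributions, with
optimal value `-∑ i, p i * log (∑ k, r k * exp (-λ d i k))`. -/
theorem w_update_closed_form
    (M N : ℕ) (hM : 0 < M) (hN : 0 < N)
    (p : Fin M → ℝ) (hp : ∀ i, p i > 0) (hps : ∑ i, p i = 1)
    (r : Fin N → ℝ) (hr : ∀ j, r j > 0) (hrs : ∑ j, r j = 1)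
    (d : Fin M → Fin N → ℝ) (hd : ∀ i j, d i j ≥ 0)
    (lam : ℝ) (hlam : lam ≥ 0)
    (wstar : Fin M → Fin N → ℝ)
    (hwstar : ∀ i j, wstar i j =
      r j * Real.exp (-lam * d i j) / ∑ k, r k * Real.exp (-lam * d i k)) :
    CondDist wstar ∧
    ((∑ i, ∑ j, wstar i j * p i * (Real.log (wstar i j) - Real.log (r j)))
        + lam * ∑ i, ∑ j, wstar i j * p i * d i j =
      -∑ i, p i * Real.log (∑ k, r k * Real.exp (-lam * d i k))) ∧
    (∀ w : Fin M → Fin N → ℝ, CondDist w →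
      ((∑ i, ∑ j, w i j * p i * (Real.log (w i j) - Real.log (r j)))
          + lam * ∑ i, ∑ j, w i j * p i * d i j ≥
        (∑ i, ∑ j, wstar i j * p i * (Real.log (wstar i j) - Real.log (r j)))
          + lam * ∑ i, ∑ j, wstar i j * p i * d i j) ∧
      ((∑ i, ∑ j, w i j * p i * (Real.log (w i j) - Real.log (r j)))
          + lam * ∑ i, ∑ j, w i j * p i * d i j =
        (∑ i, ∑ j, wstar i j * p i * (Real.log (wstar i j) - Real.log (r j)))
          + lam * ∑ i, ∑ j, wstar i j * p i * d i j → w = wstar)) := by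
  have hNe : Nonempty (Fin N) := ⟨⟨0, hN⟩⟩
  have hZ : ∀ i, 0 < ∑ k, r k * Real.exp (-lam * d i k) := fun i =>
    Finset.sum_pos (fun k _ => mul_pos (hr k) (Real.exp_pos _)) Finset.univ_nonempty
  have hpos : ∀ i j, 0 < wstar i j := fun i j => by
    rw [hwstar]
    exact div_pos (mul_pos (hr j) (Real.exp_pos _)) (hZ i)
  have hsum : ∀ i, ∑ j, wstar i j = 1 := fun i => by
    simp only [hwstar]
    rw [← Finset.sum_div]
    exact div_self (hZ i).ne'
  have hlog : ∀ i j, Real.log (wstar i j) = Real.log (r j) - lam * d i j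
      - Real.log (∑ k, r k * Real.exp (-lam * d i k)) := fun i j => by
    rw [hwstar, Real.log_div (mul_pos (hr j) (Real.exp_pos _)).ne' (hZ i).ne',
      Real.log_mul (hr j).ne' (Real.exp_pos _).ne', Real.log_exp]
    ring
  have hC : CondDist wstar := ⟨fun i j => (hpos i j).le, hsum⟩
  -- the gap is a weighted Kullback-Leibler divergence
  have key : ∀ w : Fin M → Fin N → ℝ, CondDist w →
      (∑ i, ∑ j, w i j * p i * (Real.log (w i j) - Real.log (r j)))
          + lam * ∑ i, ∑ j, w i j * p i * d i j =
      -∑ i, p i * Real.log (∑ k, r k * Real.exp (-lam * d i k))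
        + ∑ i, ∑ j, p i * (wstar i j * InformationTheory.klFun (w i j / wstar i j)) := by
    intro w hw
    rw [Finset.mul_sum, ← Finset.sum_add_distrib, ← Finset.sum_neg_distrib,
      ← Finset.sum_add_distrib]
    refine Finset.sum_congr rfl fun i _ => ?_
    rw [Finset.mul_sum, ← Finset.sum_add_distrib]
    have term : ∀ j, w i j * p i * (Real.log (w i j) - Real.log (r j))
        + lam * (w i j * p i * d i j) =
        p i * (wstar i j * InformationTheory.klFun (w i j / wstar i j))
        + p i * (w i j - wstar i j)
        - p i * Real.log (∑ k, r k * Real.exp (-lam * d i k)) * w i j := by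
      intro j
      have h0 := (hpos i j).ne'
      have hk : wstar i j * InformationTheory.klFun (w i j / wstar i j) =
          w i j * (Real.log (w i j) - Real.log (wstar i j)) + wstar i j - w i j := by
        rw [InformationTheory.klFun_apply]
        rcases eq_or_ne (w i j) 0 with h | h
        · simp [h]
        · rw [Real.log_div h h0]
          field_simp
      rw [hk, hlog]
      ring
    rw [Finset.sum_congr rfl fun j _ => term j, Finset.sum_sub_distrib,
      Finset.sum_add_distrib, ← Finset.mul_sum _ _ (p i * Real.log _),
      ← Finset.mul_sum _ (fun j => w i j - wstar i j), Finset.sum_sub_distrib, hw.2 i, hsum i]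
    ring
  have hval : (∑ i, ∑ j, wstar i j * p i * (Real.log (wstar i j) - Real.log (r j)))
        + lam * ∑ i, ∑ j, wstar i j * p i * d i j =
      -∑ i, p i * Real.log (∑ k, r k * Real.exp (-lam * d i k)) := by
    rw [key wstar hC]
    simp [div_self (hpos _ _).ne', InformationTheory.klFun_one]
  refine ⟨hC, hval, fun w hw => ?_⟩
  have hnn : ∀ i j, 0 ≤ p i * (wstar i j * InformationTheory.klFun (w i j / wstar i j)) :=
    fun i j => mul_nonneg (hp i).le (mul_nonneg (hpos i j).le
      (InformationTheory.klFun_nonneg (div_nonneg (hw.1 i j) (hpos i j).le)))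
  rw [hval, key w hw]
  refine ⟨?_, fun h => ?_⟩
  · have := Finset.sum_nonneg fun i (_ : i ∈ Finset.univ) =>
      Finset.sum_nonneg fun j (_ : j ∈ Finset.univ) => hnn i j
    linarith
  · have h0 : ∑ i, ∑ j, p i * (wstar i j * InformationTheory.klFun (w i j / wstar i j)) = 0 := by
      linarith
    funext i j
    have h1 := (Finset.sum_eq_zero_iff_of_nonneg fun i _ =>
      Finset.sum_nonneg fun j _ => hnn i j).1 h0 i (Finset.mem_univ i)
    have h2 := (Finset.sum_eq_zero_iff_of_nonneg fun j _ => hnn i j).1 h1 j (Finset.mem_univ j)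
    have h3 : InformationTheory.klFun (w i j / wstar i j) = 0 := by
      simpa [(hp i).ne', (hpos i j).ne'] using h2
    rw [InformationTheory.klFun_eq_zero_iff (div_nonneg (hw.1 i j) (hpos i j).le),
      div_eq_one_iff_eq (hpos i j).ne'] at h3
    exact h3
end

section
/- (Entropic optimal transport: uniqueness and scaling form of the minimizer.) Let p : Fin M → ℝ and r : Fin N → ℝ be probability vectors with p i > 0 for all i and r j > 0 for all j, let c : Fin M → Fin N → ℝ be any cost matrix, and let ε > 0. Then the function Π ↦ ∑ i, ∑ j, Π i j * c i j + ε * ∑ i, ∑ j, Π i j * Real.log (Π i j) attains its minimum over the set of couplings of (r, p) at a unique coupling Π*, this Π* satisfies Π* i j > 0 for all i and j, and there exist ξ : Fin M → ℝ and φ : Fin N → ℝ with ξ i > 0 and φ j > 0 such that Π* i j = ξ i * Real.exp (-c i j / ε) * φ j for all i and j. -/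
open Finset

/-- The entropic transport cost. -/
noncomputable def otF {M N : ℕ} (c : Fin M → Fin N → ℝ) (ε : ℝ) (P : Fin M → Fin N → ℝ) : ℝ :=
  (∑ i, ∑ j, P i j * c i j) + ε * ∑ i, ∑ j, P i j * Real.log (P i j)

lemma otF_eq {M N : ℕ} (c : Fin M → Fin N → ℝ) (ε : ℝ) (P : Fin M → Fin N → ℝ) :
    otF c ε P = ∑ i, ∑ j, (P i j * c i j + ε * (P i j * Real.log (P i j))) := by
  simp only [otF, Finset.mul_sum, Finset.sum_add_distrib]

lemma otF_continuous {M N : ℕ} (c : Fin M → Fin N → ℝ) (ε : ℝ) : Continuous (otF c ε) := by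
  have h : otF c ε = fun P => ∑ i, ∑ j, (P i j * c i j + ε * (P i j * Real.log (P i j))) :=
    funext (otF_eq c ε)
  rw [h]
  refine continuous_finsetSum _ fun i _ => continuous_finsetSum _ fun j _ => ?_
  have h1 : Continuous fun P : Fin M → Fin N → ℝ => P i j := by fun_prop
  exact (h1.mul continuous_const).add (continuous_const.mul (Real.continuous_mul_log.comp h1))

lemma coupling_compact {M N : ℕ} (r : Fin N → ℝ) (p : Fin M → ℝ) :
    IsCompact {P | Coupling r p P} := by
  have hK : IsCompact (Set.Icc (0 : Fin M → Fin N → ℝ) (fun i _ => p i)) := isCompact_Icc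
  refine hK.of_isClosed_subset ?_ ?_
  · have : {P | Coupling r p P} = (⋂ i, ⋂ j, {P : Fin M → Fin N → ℝ | 0 ≤ P i j}) ∩
        ((⋂ j, {P : Fin M → Fin N → ℝ | ∑ i, P i j = r j}) ∩
          (⋂ i, {P : Fin M → Fin N → ℝ | ∑ j, P i j = p i})) := by
      ext P
      simp [Coupling]
    rw [this]
    refine IsClosed.inter ?_ (IsClosed.inter ?_ ?_)
    · exact isClosed_iInter fun i => isClosed_iInter fun j =>
        isClosed_le continuous_const (by fun_prop)
    · exact isClosed_iInter fun j => isClosed_eq (by fun_prop) continuous_const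
    · exact isClosed_iInter fun i => isClosed_eq (by fun_prop) continuous_const
  · rintro P ⟨h0, h1, h2⟩
    refine ⟨fun i j => h0 i j, fun i j => ?_⟩
    change P i j ≤ p i
    rw [← h2 i]
    exact Finset.single_le_sum (f := fun j => P i j) (fun k _ => h0 i k) (Finset.mem_univ j)

lemma coupling_prod {M N : ℕ} (r : Fin N → ℝ) (p : Fin M → ℝ)
    (hp : ∀ i, p i > 0) (hps : ∑ i, p i = 1) (hr : ∀ j, r j > 0) (hrs : ∑ j, r j = 1) :
    Coupling r p (fun i j => p i * r j) := by
  refine ⟨fun i j => (mul_pos (hp i) (hr j)).le, fun j => ?_, fun i => ?_⟩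
  · rw [← Finset.sum_mul, hps, one_mul]
  · rw [← Finset.mul_sum, hrs, mul_one]

/-- A minimizer has strictly positive entries. -/
lemma min_pos {M N : ℕ} (r : Fin N → ℝ) (p : Fin M → ℝ)
    (c : Fin M → Fin N → ℝ) (ε : ℝ) (hε : ε > 0) (P Q : Fin M → Fin N → ℝ)
    (hP : Coupling r p P) (hQ : Coupling r p Q) (hQ0 : ∀ i j, 0 < Q i j)
    (hmin : ∀ R, Coupling r p R → otF c ε P ≤ otF c ε R) (a : Fin M) (b : Fin N) :
    0 < P a b := by
  by_contra hcon
  have hab : P a b = 0 := le_antisymm (not_lt.mp hcon) (hP.1 a b)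
  have key : ∀ t : ℝ, 0 < t → t < 1 →
      otF c ε P ≤ otF c ε Q + ε * Q a b * Real.log t := by
    intro t ht ht1
    set R : Fin M → Fin N → ℝ := fun i j => (1 - t) * P i j + t * Q i j with hR
    have hRc : Coupling r p R := by
      refine ⟨fun i j => ?_, fun j => ?_, fun i => ?_⟩
      · have h1 := hP.1 i j
        have h2 := hQ.1 i j
        have h3 : 0 ≤ 1 - t := by linarith
        simp only [hR]
        positivity
      · simp only [hR, Finset.sum_add_distrib, ← Finset.mul_sum, hP.2.1, hQ.2.1]; ring
      · simp only [hR, Finset.sum_add_distrib, ← Finset.mul_sum, hP.2.2, hQ.2.2]; ring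
    have hle := hmin R hRc
    have hconv : ∀ i j, R i j * Real.log (R i j) ≤
        (1 - t) * (P i j * Real.log (P i j)) + t * (Q i j * Real.log (Q i j)) := by
      intro i j
      have := Real.convexOn_mul_log.2 (Set.mem_Ici.mpr (hP.1 i j)) (Set.mem_Ici.mpr (hQ.1 i j))
        (show (0 : ℝ) ≤ 1 - t by linarith) ht.le (by ring)
      simpa [hR] using this
    have hconv2 : ∀ i j, R i j * c i j + ε * (R i j * Real.log (R i j)) ≤
        ((1 - t) * (P i j * c i j + ε * (P i j * Real.log (P i j))) +
          t * (Q i j * c i j + ε * (Q i j * Real.log (Q i j)))) +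
        (if i = a then (if j = b then ε * (t * Q a b * Real.log t) else 0) else 0) := by
      intro i j
      have h2 := mul_le_mul_of_nonneg_left (hconv i j) hε.le
      have hc : R i j * c i j = (1 - t) * (P i j * c i j) + t * (Q i j * c i j) := by
        simp only [hR]; ring
      split_ifs with h h'
      · subst h h'
        have hRR : R i j = t * Q i j := by simp [hR, hab]
        have hl : Real.log (R i j) = Real.log t + Real.log (Q i j) := by
          rw [hRR, Real.log_mul ht.ne' (hQ0 i j).ne']
        rw [hl, hRR, hab]
        apply le_of_eq
        ring
      · linarith
      · linarith
    have hsum : otF c ε R ≤ (1 - t) * otF c ε P + t * otF c ε Q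
        + ε * (t * Q a b * Real.log t) := by
      simp only [otF_eq]
      refine (Finset.sum_le_sum fun i _ => Finset.sum_le_sum fun j _ => hconv2 i j).trans
        (le_of_eq ?_)
      simp only [Finset.sum_add_distrib, ← Finset.mul_sum]
      congr 1
      rw [Finset.sum_eq_single a, Finset.sum_eq_single b] <;> simp +contextual
    have h3 : t * otF c ε P ≤ t * (otF c ε Q + ε * Q a b * Real.log t) := by nlinarith
    exact le_of_mul_le_mul_left h3 ht
  have hq : 0 < ε * Q a b := mul_pos hε (hQ0 a b)
  set K := |otF c ε Q - otF c ε P| + 1 with hK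
  have hKp : 0 < K := by positivity
  have := key (Real.exp (-(K / (ε * Q a b)))) (Real.exp_pos _)
    (by rw [Real.exp_lt_one_iff]; have := div_pos hKp hq; linarith)
  rw [Real.log_exp] at this
  have h5 : ε * Q a b * -(K / (ε * Q a b)) = -K := by
    rw [mul_neg, mul_div_cancel₀ _ hq.ne']
  rw [h5] at this
  have := le_abs_self (otF c ε Q - otF c ε P)
  linarith

/-- First order condition at a positive minimizer. -/
lemma min_foc {M N : ℕ} (r : Fin N → ℝ) (p : Fin M → ℝ)
    (c : Fin M → Fin N → ℝ) (ε : ℝ) (P : Fin M → Fin N → ℝ)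
    (hP : Coupling r p P) (hP0 : ∀ i j, 0 < P i j)
    (hmin : ∀ R, Coupling r p R → otF c ε P ≤ otF c ε R)
    (D : Fin M → Fin N → ℝ) (hD1 : ∀ j, ∑ i, D i j = 0) (hD2 : ∀ i, ∑ j, D i j = 0) :
    ∑ i, ∑ j, D i j * (c i j + ε * (Real.log (P i j) + 1)) = 0 := by
  have hder : HasDerivAt (fun t : ℝ => otF c ε (fun i j => P i j + t * D i j))
      (∑ i, ∑ j, D i j * (c i j + ε * (Real.log (P i j) + 1))) 0 := by
    simp only [otF_eq]
    refine HasDerivAt.fun_sum fun i _ => HasDerivAt.fun_sum fun j _ => ?_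
    have h1 : HasDerivAt (fun t : ℝ => P i j + t * D i j) (D i j) 0 := by
      simpa using ((hasDerivAt_id (0 : ℝ)).mul_const (D i j)).const_add (P i j)
    have h2 : HasDerivAt (fun x : ℝ => x * Real.log x) (Real.log (P i j) + 1)
        ((fun t : ℝ => P i j + t * D i j) 0) := by
      simpa using Real.hasDerivAt_mul_log (hP0 i j).ne'
    have h3 := h2.comp (0 : ℝ) h1
    have h4 := (h1.mul_const (c i j)).add (h3.const_mul ε)
    have h5 : D i j * (c i j + ε * (Real.log (P i j) + 1)) =
        D i j * c i j + ε * ((Real.log (P i j) + 1) * D i j) := by ring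
    rw [h5]
    exact h4
  have hloc : IsLocalMin (fun t : ℝ => otF c ε (fun i j => P i j + t * D i j)) 0 := by
    have hev : ∀ᶠ t : ℝ in nhds 0, ∀ i j, 0 < P i j + t * D i j := by
      rw [Filter.eventually_all]
      intro i
      rw [Filter.eventually_all]
      intro j
      have hc : Continuous fun t : ℝ => P i j + t * D i j := by fun_prop
      exact hc.continuousAt.eventually_const_lt (by simpa using hP0 i j)
    filter_upwards [hev] with t ht
    have := hmin (fun i j => P i j + t * D i j) ⟨fun i j => (ht i j).le,
      fun j => by simp [Finset.sum_add_distrib, ← Finset.mul_sum, hD1, hP.2.1],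
      fun i => by simp [Finset.sum_add_distrib, ← Finset.mul_sum, hD2, hP.2.2]⟩
    simpa using this
  exact hloc.hasDerivAt_eq_zero hder

lemma kl_nonneg {x y : ℝ} (hx : 0 ≤ x) (hy : 0 < y) :
    0 ≤ x * Real.log x - x * Real.log y - x + y ∧
    (x * Real.log x - x * Real.log y - x + y = 0 → x = y) := by
  rcases hx.eq_or_lt with rfl | hx
  · simp only [zero_mul]
    exact ⟨by linarith, fun h => by linarith⟩
  · have e : x * Real.log x - x * Real.log y - x + y
        = x * ((y / x - 1) - Real.log (y / x)) := by
      rw [Real.log_div hy.ne' hx.ne']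
      field_simp
      ring
    rw [e]
    have hyx : 0 < y / x := div_pos hy hx
    refine ⟨mul_nonneg hx.le (by linarith [Real.log_le_sub_one_of_pos hyx]), fun h => ?_⟩
    by_contra hne
    have h1 : y / x ≠ 1 := by
      intro h1
      rw [div_eq_one_iff_eq hx.ne'] at h1
      exact hne h1.symm
    have := Real.log_lt_sub_one_of_pos hyx h1
    have := mul_pos hx (sub_pos.mpr this)
    linarith

/-- Entropic optimal transport: the entropy-regularized transport cost attains its minimum
over the couplings of `(r, p)` at a unique coupling `Π*`, which is entrywise positive and of
the scaling form `Π* i j = ξ i * exp (-c i j / ε) * φ j`. -/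
theorem entropic_ot_unique_scaling
    (M N : ℕ) (hM : 0 < M) (hN : 0 < N)
    (p : Fin M → ℝ) (hp : ∀ i, p i > 0) (hps : ∑ i, p i = 1)
    (r : Fin N → ℝ) (hr : ∀ j, r j > 0) (hrs : ∑ j, r j = 1)
    (c : Fin M → Fin N → ℝ) (ε : ℝ) (hε : ε > 0) :
    ∃ Pistar : Fin M → Fin N → ℝ, Coupling r p Pistar ∧
      (∀ Pi : Fin M → Fin N → ℝ, Coupling r p Pi →
        (∑ i, ∑ j, Pistar i j * c i j) + ε * ∑ i, ∑ j, Pistar i j * Real.log (Pistar i j) ≤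
          (∑ i, ∑ j, Pi i j * c i j) + ε * ∑ i, ∑ j, Pi i j * Real.log (Pi i j)) ∧
      (∀ Pi : Fin M → Fin N → ℝ, Coupling r p Pi →
        (∑ i, ∑ j, Pi i j * c i j) + ε * ∑ i, ∑ j, Pi i j * Real.log (Pi i j) =
          (∑ i, ∑ j, Pistar i j * c i j) + ε * ∑ i, ∑ j, Pistar i j * Real.log (Pistar i j) →
        Pi = Pistar) ∧
      (∀ i j, Pistar i j > 0) ∧
      (∃ ξ : Fin M → ℝ, ∃ φ : Fin N → ℝ, (∀ i, ξ i > 0) ∧ (∀ j, φ j > 0) ∧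
        ∀ i j, Pistar i j = ξ i * Real.exp (-c i j / ε) * φ j) := by
  have hQ := coupling_prod r p hp hps hr hrs
  obtain ⟨P, hP, hPm⟩ := (coupling_compact r p).exists_isMinOn ⟨_, hQ⟩
    (otF_continuous c ε).continuousOn
  have hmin : ∀ R, Coupling r p R → otF c ε P ≤ otF c ε R := fun R hR => hPm hR
  have hpos : ∀ i j, 0 < P i j := fun i j =>
    min_pos r p c ε hε P _ hP hQ (fun i j => mul_pos (hp i) (hr j)) hmin i j
  have hfoc := min_foc r p c ε P hP hpos hmin
  refine ⟨P, hP, hmin, ?_, hpos, ?_⟩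
  · intro R hR heq
    change otF c ε R = otF c ε P at heq
    have h1 := hfoc (fun i j => R i j - P i j)
      (fun j => by simp [Finset.sum_sub_distrib, hR.2.1, hP.2.1])
      (fun i => by simp [Finset.sum_sub_distrib, hR.2.2, hP.2.2])
    have h2 : otF c ε R - otF c ε P =
        (∑ i, ∑ j, (R i j - P i j) * (c i j + ε * (Real.log (P i j) + 1))) +
        ε * ∑ i, ∑ j, (R i j * Real.log (R i j) - R i j * Real.log (P i j) - R i j + P i j) := by
      simp only [otF_eq, Finset.mul_sum, ← Finset.sum_add_distrib, ← Finset.sum_sub_distrib]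
      refine Finset.sum_congr rfl fun i _ => Finset.sum_congr rfl fun j _ => ?_
      ring
    rw [h1, heq, sub_self, zero_add] at h2
    have h3 := (mul_eq_zero.mp h2.symm).resolve_left hε.ne'
    have hk := fun i j => kl_nonneg (hR.1 i j) (hpos i j)
    rw [Finset.sum_eq_zero_iff_of_nonneg
      (fun i _ => Finset.sum_nonneg fun j _ => (hk i j).1)] at h3
    funext i j
    have h4 := h3 i (Finset.mem_univ i)
    rw [Finset.sum_eq_zero_iff_of_nonneg (fun j _ => (hk i j).1)] at h4
    exact (hk i j).2 (h4 j (Finset.mem_univ j))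
  · set a : Fin M := ⟨0, hM⟩
    set b : Fin N := ⟨0, hN⟩
    have hadd : ∀ i j, c i j + ε * Real.log (P i j) = (c i b + ε * Real.log (P i b)) +
        ((c a j + ε * Real.log (P a j)) - (c a b + ε * Real.log (P a b))) := by
      intro i j
      have h := hfoc (fun k l => ((if k = i then 1 else 0) - (if k = a then 1 else 0)) *
          ((if l = j then 1 else 0) - (if l = b then 1 else 0)))
        (fun l => by rw [← Finset.sum_mul]; simp)
        (fun k => by rw [← Finset.mul_sum]; simp)
      simp only [mul_assoc, ← Finset.mul_sum] at h
      simp only [sub_mul, Finset.sum_sub_distrib, ite_mul, one_mul, zero_mul,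
        Finset.sum_ite_eq', Finset.mem_univ, if_true] at h
      linarith
    refine ⟨fun i => Real.exp ((c i b + ε * Real.log (P i b)) / ε),
      fun j => Real.exp (((c a j + ε * Real.log (P a j)) - (c a b + ε * Real.log (P a b))) / ε),
      fun i => Real.exp_pos _, fun j => Real.exp_pos _, fun i j => ?_⟩
    rw [← Real.exp_add, ← Real.exp_add, ← add_div, ← add_div]
    have h := hadd i j
    have e : (c i b + ε * Real.log (P i b) + -c i j +
        ((c a j + ε * Real.log (P a j)) - (c a b + ε * Real.log (P a b)))) / ε
        = Real.log (P i j) := by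
      rw [div_eq_iff hε.ne']
      linarith
    rw [e, Real.exp_log (hpos i j)]
end

section
/- (Unique root of the r-update dual function and validity of the resulting r.) Let a : Fin N → ℝ with a j > 0 for all j and ∑ j, a j = 1, and let b : Fin N → ℝ. Define H(η) = ∑ j, a j / (η - b j) - 1 on the interval (max over j of b j, ∞). Then H is strictly decreasing on this interval, H(η) → +∞ as η decreases to max_j b j, and H(η) → -1 as η → ∞; hence there exists a unique η* > max_j b j with H(η*) = 0, and the vector r defined by r j = a j / (η* - b j) satisfies r j > 0 for all j and ∑ j, r j = 1. -/
open Finset Filter Topology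

/-- Unique root of the `r`-update dual function `H(η) = ∑ j, a j / (η - b j) - 1` on
`(max_j b j, ∞)`: `H` is strictly decreasing there, tends to `+∞` as `η ↓ max_j b j` and to
`-1` as `η → ∞`, so it has a unique root `η* > max_j b j`; the resulting vector
`r j = a j / (η* - b j)` is positive and sums to `1`. -/
theorem r_update_dual_unique_root
    (N : ℕ) (hN : 0 < N)
    (a : Fin N → ℝ) (ha : ∀ j, a j > 0) (has : ∑ j, a j = 1)
    (b : Fin N → ℝ) (bmax : ℝ) (hbmax : IsGreatest (Set.range b) bmax) :
    StrictAntiOn (fun η : ℝ => (∑ j, a j / (η - b j)) - 1) (Set.Ioi bmax) ∧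
    Tendsto (fun η : ℝ => (∑ j, a j / (η - b j)) - 1) (𝓝[>] bmax) atTop ∧
    Tendsto (fun η : ℝ => (∑ j, a j / (η - b j)) - 1) atTop (𝓝 (-1)) ∧
    (∃! η : ℝ, η > bmax ∧ (∑ j, a j / (η - b j)) - 1 = 0) ∧
    (∀ η : ℝ, η > bmax → (∑ j, a j / (η - b j)) - 1 = 0 →
      (∀ j, a j / (η - b j) > 0) ∧ (∑ j, a j / (η - b j)) = 1) := by
  obtain ⟨⟨j0, hj0⟩, hub⟩ := hbmax
  have hb : ∀ j, b j ≤ bmax := fun j => hub ⟨j, rfl⟩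
  have hpos : ∀ η : ℝ, bmax < η → ∀ j, 0 < η - b j := fun η h j => by
    linarith [hb j]
  have h1 : StrictAntiOn (fun η : ℝ => (∑ j, a j / (η - b j)) - 1) (Set.Ioi bmax) := by
    intro x hx y hy hxy
    have : ∑ j, a j / (y - b j) < ∑ j, a j / (x - b j) := by
      apply Finset.sum_lt_sum_of_nonempty ⟨j0, Finset.mem_univ _⟩
      intro j _
      exact div_lt_div_of_pos_left (ha j) (hpos x hx j) (by linarith)
    simpa using this
  have h2 : Tendsto (fun η : ℝ => (∑ j, a j / (η - b j)) - 1) (𝓝[>] bmax) atTop := by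
    have hz : Tendsto (fun η : ℝ => η - b j0) (𝓝[>] bmax) (𝓝[>] 0) := by
      apply tendsto_nhdsWithin_of_tendsto_nhds_of_eventually_within
      · have : Tendsto (fun η : ℝ => η - b j0) (𝓝 bmax) (𝓝 (bmax - b j0)) :=
          (continuous_id.sub continuous_const).tendsto _
        rw [hj0, sub_self] at this
        rw [hj0]
        exact this.mono_left nhdsWithin_le_nhds
      · filter_upwards [self_mem_nhdsWithin] with η hη
        exact hpos η hη j0
    have hd : Tendsto (fun η : ℝ => a j0 * (η - b j0)⁻¹) (𝓝[>] bmax) atTop :=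
      (tendsto_inv_nhdsGT_zero.comp hz).const_mul_atTop (ha j0)
    have hd' := tendsto_atTop_add_const_right _ (-1 : ℝ) hd
    refine tendsto_atTop_mono' _ ?_ hd'
    filter_upwards [self_mem_nhdsWithin] with η hη
    have : a j0 / (η - b j0) ≤ ∑ j, a j / (η - b j) :=
      Finset.single_le_sum (f := fun j => a j / (η - b j))
        (fun j _ => (div_pos (ha j) (hpos η hη j)).le) (Finset.mem_univ j0)
    rw [← div_eq_mul_inv]
    linarith
  have h3 : Tendsto (fun η : ℝ => (∑ j, a j / (η - b j)) - 1) atTop (𝓝 (-1)) := by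
    have : Tendsto (fun η : ℝ => ∑ j, a j / (η - b j)) atTop (𝓝 (∑ _j : Fin N, (0 : ℝ))) := by
      apply tendsto_finsetSum
      intro j _
      exact (tendsto_atTop_add_const_right _ (-b j) tendsto_id).const_div_atTop (a j)
    simpa using this.sub_const 1
  have hc : ContinuousOn (fun η : ℝ => (∑ j, a j / (η - b j)) - 1) (Set.Ioi bmax) := by
    refine ContinuousOn.sub (continuousOn_finsetSum _ fun j _ => ?_) continuousOn_const
    exact continuousOn_const.div (continuousOn_id.sub continuousOn_const)
      fun η hη => (hpos η hη j).ne'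
  refine ⟨h1, h2, h3, ?_, ?_⟩
  · obtain ⟨η, hη, h0⟩ := isPreconnected_Ioi.intermediate_value_Ioi
      (le_principal_iff.2 (Ioi_mem_atTop bmax)) (le_principal_iff.2 self_mem_nhdsWithin)
      hc h3 h2 (show (0 : ℝ) ∈ Set.Ioi (-1) by simp)
    exact ⟨η, ⟨hη, h0⟩, fun y hy => h1.injOn hy.1 hη (hy.2.trans h0.symm)⟩
  · intro η hη h0
    exact ⟨fun j => div_pos (ha j) (hpos η hη j), by linarith⟩
end

section
/- (Sinkhorn scaling theorem for positive matrices.) Let K : Fin M → Fin N → ℝ with K i j > 0 for all i, j, and let p : Fin M → ℝ and r : Fin N → ℝ be probability vectors with p i > 0 for all i and r j > 0 for all j. Then there exist φ : Fin M → ℝ and ψ : Fin N → ℝ with φ i > 0 and ψ j > 0 such that the matrix Π i j = φ i * K i j * ψ j satisfies ∑ j, Π i j = p i for every i and ∑ i, Π i j = r j for every j. -/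
open Finset

/-- The dual potential. -/
noncomputable def sinkG {M N : ℕ} (K : Fin M → Fin N → ℝ) (p : Fin M → ℝ) (r : Fin N → ℝ)
    (u : Fin N → ℝ) : ℝ :=
  ∑ i, p i * Real.log (∑ j, K i j * Real.exp (u j)) - ∑ j, r j * u j

theorem sinkG_exists_min {M N : ℕ} (hN : 0 < N)
    (K : Fin M → Fin N → ℝ) (hK : ∀ i j, K i j > 0)
    (p : Fin M → ℝ) (hp : ∀ i, p i > 0) (hps : ∑ i, p i = 1)
    (r : Fin N → ℝ) (hr : ∀ j, r j > 0) (hrs : ∑ j, r j = 1) :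
    ∃ u, ∀ v, sinkG K p r u ≤ sinkG K p r v := by
  haveI : Nonempty (Fin N) := ⟨⟨0, hN⟩⟩
  have hS : ∀ (u : Fin N → ℝ) i, 0 < ∑ j, K i j * Real.exp (u j) := fun u i =>
    Finset.sum_pos (fun j _ => mul_pos (hK i j) (Real.exp_pos _)) Finset.univ_nonempty
  have hcont : Continuous (sinkG K p r) := by
    unfold sinkG
    refine Continuous.sub ?_ (by fun_prop)
    refine continuous_finsetSum _ fun i _ => ?_
    refine continuous_const.mul (Continuous.log (by fun_prop) fun u => (hS u i).ne')
  have hshift : ∀ (u : Fin N → ℝ) (c : ℝ), sinkG K p r (fun j => u j - c) = sinkG K p r u := by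
    intro u c
    unfold sinkG
    have h1 : ∀ i, Real.log (∑ j, K i j * Real.exp (u j - c))
        = Real.log (∑ j, K i j * Real.exp (u j)) - c := by
      intro i
      have : ∑ j, K i j * Real.exp (u j - c)
          = (∑ j, K i j * Real.exp (u j)) * Real.exp (-c) := by
        rw [Finset.sum_mul]
        refine Finset.sum_congr rfl fun j _ => ?_
        rw [sub_eq_add_neg, Real.exp_add]; ring
      rw [this, Real.log_mul (hS u i).ne' (Real.exp_pos _).ne', Real.log_exp]; ring
    simp only [h1, mul_sub, Finset.sum_sub_distrib, ← Finset.sum_mul, hps, hrs]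
    ring
  obtain ⟨j₀, hj₀⟩ := Finite.exists_min r
  set L : ℝ := -∑ i, ∑ j, |Real.log (K i j)| with hL
  have hLK : ∀ i j, L ≤ Real.log (K i j) := by
    intro i j
    have h1 : |Real.log (K i j)| ≤ ∑ j, |Real.log (K i j)| :=
      Finset.single_le_sum (f := fun j => |Real.log (K i j)|)
        (fun _ _ => abs_nonneg _) (Finset.mem_univ j)
    have h2 : ∑ j, |Real.log (K i j)| ≤ ∑ i, ∑ j, |Real.log (K i j)| :=
      Finset.single_le_sum (f := fun i => ∑ j, |Real.log (K i j)|)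
        (fun _ _ => Finset.sum_nonneg fun _ _ => abs_nonneg _) (Finset.mem_univ i)
    have := neg_abs_le (Real.log (K i j))
    linarith
  set C : ℝ := |sinkG K p r 0 - L| / r j₀ with hC
  have hC0 : 0 ≤ C := div_nonneg (abs_nonneg _) (hr j₀).le
  have hCr : sinkG K p r 0 - L ≤ r j₀ * C := by
    rw [hC, mul_div_cancel₀ _ (hr j₀).ne']; exact le_abs_self _
  obtain ⟨u, hu, hmin⟩ := (isCompact_Icc (a := fun _ : Fin N => -C) (b := fun _ => 0)).exists_isMinOn
    ⟨0, fun _ => by simpa using hC0, fun _ => le_rfl⟩ hcont.continuousOn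
  have hu0 : sinkG K p r u ≤ sinkG K p r 0 :=
    hmin ⟨fun _ => by simpa using hC0, fun _ => le_rfl⟩
  refine ⟨u, fun v => ?_⟩
  obtain ⟨m, hm⟩ := Finite.exists_max v
  rw [← hshift v (v m)]
  by_cases hb : ∀ j, -C ≤ v j - v m
  · exact hmin ⟨hb, fun j => by simpa using hm j⟩
  · push Not at hb
    obtain ⟨k, hk⟩ := hb
    refine hu0.trans ?_
    have h1 : L ≤ ∑ i, p i * Real.log (∑ j, K i j * Real.exp (v j - v m)) := by
      calc L = ∑ i, p i * L := by rw [← Finset.sum_mul, hps, one_mul]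
        _ ≤ _ := by
          refine Finset.sum_le_sum fun i _ => mul_le_mul_of_nonneg_left ?_ (hp i).le
          refine (hLK i m).trans (Real.log_le_log (hK i m) ?_)
          have := Finset.single_le_sum (f := fun j => K i j * Real.exp (v j - v m))
            (fun j _ => (mul_pos (hK i j) (Real.exp_pos _)).le) (Finset.mem_univ m)
          simpa using this
    have h2 : r k * (v m - v k) ≤ ∑ j, r j * (v m - v j) :=
      Finset.single_le_sum (f := fun j => r j * (v m - v j))
        (fun j _ => mul_nonneg (hr j).le (by linarith [hm j])) (Finset.mem_univ k)
    have h3 : ∑ j, r j * (v m - v j) = - ∑ j, r j * (v j - v m) := by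
      rw [← Finset.sum_neg_distrib]
      exact Finset.sum_congr rfl fun j _ => by ring
    have h4 : r j₀ * C ≤ r k * (v m - v k) :=
      mul_le_mul (hj₀ k) (by linarith) hC0 (hr k).le
    have h5 : sinkG K p r (fun j => v j - v m) =
      ∑ i, p i * Real.log (∑ j, K i j * Real.exp (v j - v m)) - ∑ j, r j * (v j - v m) := rfl
    rw [h5]
    linarith

/-- Sinkhorn scaling theorem for positive matrices: for an entrywise positive matrix `K`
and positive probability vectors `p` and `r`, there are positive diagonal scalings `φ`, `ψ`
such that `Π i j = φ i * K i j * ψ j` has row sums `p` and column sums `r`. -/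
theorem sinkhorn_scaling_positive_matrix
    (M N : ℕ) (hM : 0 < M) (hN : 0 < N)
    (K : Fin M → Fin N → ℝ) (hK : ∀ i j, K i j > 0)
    (p : Fin M → ℝ) (hp : ∀ i, p i > 0) (hps : ∑ i, p i = 1)
    (r : Fin N → ℝ) (hr : ∀ j, r j > 0) (hrs : ∑ j, r j = 1) :
    ∃ φ : Fin M → ℝ, ∃ ψ : Fin N → ℝ, (∀ i, φ i > 0) ∧ (∀ j, ψ j > 0) ∧
      (∀ i, ∑ j, φ i * K i j * ψ j = p i) ∧
      (∀ j, ∑ i, φ i * K i j * ψ j = r j) := by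
  obtain ⟨u, hu⟩ := sinkG_exists_min hN K hK p hp hps r hr hrs
  haveI : Nonempty (Fin N) := ⟨⟨0, hN⟩⟩
  have hS : ∀ i, 0 < ∑ j, K i j * Real.exp (u j) := fun i =>
    Finset.sum_pos (fun j _ => mul_pos (hK i j) (Real.exp_pos _)) Finset.univ_nonempty
  refine ⟨fun i => p i / ∑ j, K i j * Real.exp (u j), fun j => Real.exp (u j),
    fun i => div_pos (hp i) (hS i), fun j => Real.exp_pos _, fun i => ?_, fun k => ?_⟩
  · simp only [mul_assoc]
    rw [← Finset.mul_sum, div_mul_cancel₀ _ (hS i).ne']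
  · set e : Fin N → ℝ := Pi.single k 1 with he
    have hlin : ∀ j, HasDerivAt (fun t : ℝ => u j + t * e j) (e j) 0 := fun j => by
      simpa using ((hasDerivAt_id (0 : ℝ)).mul_const (e j)).const_add (u j)
    have hsum : ∀ i, HasDerivAt (fun t : ℝ => ∑ j, K i j * Real.exp (u j + t * e j))
        (∑ j, K i j * (Real.exp (u j) * e j)) 0 := fun i => by
      refine HasDerivAt.fun_sum fun j _ => ?_
      simpa using ((hlin j).exp).const_mul (K i j)
    have hG : HasDerivAt (fun t : ℝ => sinkG K p r (fun j => u j + t * e j))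
        (∑ i, p i * ((∑ j, K i j * (Real.exp (u j) * e j)) / ∑ j, K i j * Real.exp (u j))
          - ∑ j, r j * e j) 0 := by
      unfold sinkG
      refine HasDerivAt.fun_sub (HasDerivAt.fun_sum fun i _ => ?_)
        (HasDerivAt.fun_sum fun j _ => (hlin j).const_mul (r j))
      have := ((hsum i).log (by simpa using (hS i).ne')).const_mul (p i)
      simpa using this
    have hmin : IsLocalMin (fun t : ℝ => sinkG K p r (fun j => u j + t * e j)) 0 :=
      Filter.Eventually.of_forall fun t => by simpa using hu _
    have h0 := hmin.hasDerivAt_eq_zero hG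
    have h1 : ∀ f : Fin N → ℝ, ∑ j, f j * e j = f k := fun f => by
      simp [he, Pi.single_apply]
    simp only [← mul_assoc] at h0
    rw [h1 r] at h0
    rw [← sub_eq_zero, ← h0]
    congr 1
    refine Finset.sum_congr rfl fun i _ => ?_
    rw [h1 (fun j => K i j * Real.exp (u j))]
    ring
end
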